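/- arXiv:1812.11101 — 2 statements merged into one kernel-verified Lean document; each statement's English description precedes it below -/
import Mathlib

section
/- For every real h, the limit Λ(h) = −lim_{T→∞} (1/T) log F_T(h) exists and is finite, where F_T(h) is the probability that the Slepian process stays below h on [0,T]. (Existence of Shepp's constant.) -/
open MeasureTheory ProbabilityTheory Real Set Filter

/-- The standard normal density `φ(x) = (2π)^{-1/2} exp(-x²/2)`. -/
noncomputable def stdPhi (x : ℝ) : ℝ := (Real.sqrt (2 * Real.pi))⁻¹ * Real.exp (-x ^ 2 / 2)

/-- The standard normal distribution function `Φ(x) = ∫_{-∞}^x φ(t) dt`. -/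
noncomputable def stdCdf (x : ℝ) : ℝ := ∫ t in Set.Iic x, stdPhi t

/-- `S` is a Slepian process on the probability space `(Ω, μ)`: a stationary Gaussian
process with continuous sample paths, mean zero and covariance
`E[S(t)S(t')] = max 0 (1 - |t - t'|)` (e.g. `S(t) = W(t+1) - W(t)` for a standard
Brownian motion `W`). -/
def IsSlepian {Ω : Type*} [MeasurableSpace Ω] (μ : Measure Ω) (S : ℝ → Ω → ℝ) : Prop :=
  IsProbabilityMeasure μ ∧
  (∀ t, Measurable (S t)) ∧
  (∀ ω, Continuous fun t => S t ω) ∧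
  (∀ (n : ℕ) (t c : Fin n → ℝ), ∃ v : NNReal,
      Measure.map (fun ω => ∑ i, c i * S (t i) ω) μ = gaussianReal 0 v) ∧
  (∀ t, ∫ ω, S t ω ∂μ = 0) ∧
  (∀ t t', ∫ ω, S t ω * S t' ω ∂μ = max 0 (1 - |t - t'|))

/-- `F_T(h)`: the probability that the process `S` stays below `h` on `[0, T]`. -/
noncomputable def slepF {Ω : Type*} [MeasurableSpace Ω] (μ : Measure Ω)
    (S : ℝ → Ω → ℝ) (T h : ℝ) : ℝ :=
  (μ {ω | ∀ t ∈ Set.Icc (0 : ℝ) T, S t ω < h}).toReal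

/-- Chebyshev's association inequality for two antitone functions of a real random variable. -/
lemma integral_mul_integral_le_of_antitone (ν : Measure ℝ) [IsProbabilityMeasure ν]
    {f g : ℝ → ℝ} (hf : Antitone f) (hg : Antitone g) (hf' : ∀ x, f x ∈ Icc (0 : ℝ) 1)
    (hg' : ∀ x, g x ∈ Icc (0 : ℝ) 1) :
    (∫ x, f x ∂ν) * ∫ x, g x ∂ν ≤ ∫ x, f x * g x ∂ν := by
  have hfi : Integrable f ν := Integrable.of_mem_Icc 0 1 hf.measurable.aemeasurable (.of_forall hf')
  have hgi : Integrable g ν := Integrable.of_mem_Icc 0 1 hg.measurable.aemeasurable (.of_forall hg')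
  have hfg : Integrable (fun x => f x * g x) ν :=
    Integrable.of_mem_Icc 0 1 (hf.measurable.mul hg.measurable).aemeasurable
      (.of_forall fun x => ⟨mul_nonneg (hf' x).1 (hg' x).1,
        mul_le_one₀ (hf' x).2 (hg' x).1 (hg' x).2⟩)
  have expand : ∀ a b c d : ℝ, ∫ y, (a * (f y * g y) + b * f y + c * g y + d) ∂ν
      = a * (∫ y, f y * g y ∂ν) + b * (∫ y, f y ∂ν) + c * (∫ y, g y ∂ν) + d := by
    intro a b c d
    have h1 : Integrable (fun y => a * (f y * g y)) ν := hfg.const_mul a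
    have h2 : Integrable (fun y => b * f y) ν := hfi.const_mul b
    have h3 : Integrable (fun y => c * g y) ν := hgi.const_mul c
    have h12 : Integrable (fun y => a * (f y * g y) + b * f y) ν := h1.add h2
    have h123 : Integrable (fun y => a * (f y * g y) + b * f y + c * g y) ν := h12.add h3
    rw [integral_add h123 (integrable_const d), integral_add h12 h3, integral_add h1 h2]
    simp [integral_const_mul]
  have key : ∀ x, 0 ≤ 1 * (f x * g x) + -(∫ y, g y ∂ν) * f x + -(∫ y, f y ∂ν) * g x
      + ∫ y, f y * g y ∂ν := by
    intro x
    have h : 0 ≤ ∫ y, (f y - f x) * (g y - g x) ∂ν := by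
      refine integral_nonneg fun y => ?_
      rcases le_total x y with h | h
      · exact mul_nonneg_of_nonpos_of_nonpos (sub_nonpos.2 (hf h)) (sub_nonpos.2 (hg h))
      · exact mul_nonneg (sub_nonneg.2 (hf h)) (sub_nonneg.2 (hg h))
    have e : ∀ y, (f y - f x) * (g y - g x)
        = 1 * (f y * g y) + -g x * f y + -f x * g y + f x * g x := fun y => by ring
    simp_rw [e, expand] at h
    linarith
  have h : (0 : ℝ) ≤ ∫ x, _ ∂ν := integral_nonneg key
  rw [expand] at h
  linarith

/-- The Harris inequality: antitone functions of independent variables are positively correlated. -/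
lemma integral_mul_integral_le_pi_of_antitone (ν : Measure ℝ) [IsProbabilityMeasure ν] (n : ℕ)
    {f g : (Fin n → ℝ) → ℝ} (hf : Antitone f) (hg : Antitone g)
    (hfm : Measurable f) (hgm : Measurable g) (hf' : ∀ x, f x ∈ Icc (0 : ℝ) 1)
    (hg' : ∀ x, g x ∈ Icc (0 : ℝ) 1) :
    (∫ x, f x ∂(Measure.pi fun _ => ν)) * ∫ x, g x ∂(Measure.pi fun _ => ν)
      ≤ ∫ x, f x * g x ∂(Measure.pi fun _ => ν) := by
  induction n with
  | zero =>
    have e : ∀ u : (Fin 0 → ℝ) → ℝ, u = fun _ => u default :=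
      fun u => funext fun x => congrArg u (Subsingleton.elim _ _)
    rw [e f, e g]
    simp
  | succ n ih =>
    have hmp := (measurePreserving_piFinSuccAbove (fun _ : Fin (n + 1) => ν) 0).symm
    have hmem : ∀ x, f x * g x ∈ Icc (0 : ℝ) 1 := fun x =>
      ⟨mul_nonneg (hf' x).1 (hg' x).1, mul_le_one₀ (hf' x).2 (hg' x).1 (hg' x).2⟩
    have hcons : Measurable fun p : ℝ × (Fin n → ℝ) => (Fin.cons p.1 p.2 : Fin (n + 1) → ℝ) := by
      rw [measurable_pi_iff]
      refine Fin.cases ?_ fun i => ?_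
      · simpa using measurable_fst
      · simpa [Function.comp_def] using (measurable_pi_apply i).comp measurable_snd
    have split : ∀ u : (Fin (n + 1) → ℝ) → ℝ, Measurable u → (∀ x, u x ∈ Icc (0 : ℝ) 1) →
        ∫ x, u x ∂(Measure.pi fun _ => ν)
          = ∫ a, ∫ y, u (Fin.cons a y) ∂(Measure.pi fun _ => ν) ∂ν := by
      intro u hu hu'
      rw [← hmp.integral_comp', integral_prod]
      · simp only [MeasurableEquiv.piFinSuccAbove_symm_apply, Fin.insertNthEquiv,
          Fin.insertNth_zero, Equiv.coe_fn_mk]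
        rfl
      · exact Integrable.of_mem_Icc 0 1 (hu.comp (MeasurableEquiv.measurable _)).aemeasurable
          (.of_forall fun x => hu' _)
    rw [split f hfm hf', split g hgm hg', split (fun x => f x * g x) (hfm.mul hgm) hmem]
    have int : ∀ u : (Fin (n + 1) → ℝ) → ℝ, Measurable u → (∀ x, u x ∈ Icc (0 : ℝ) 1) → ∀ a,
        Integrable (fun y => u (Fin.cons a y)) (Measure.pi fun _ : Fin n => ν) := fun u hu hu' a =>
      Integrable.of_mem_Icc 0 1 (hu.comp (hcons.comp measurable_prodMk_left)).aemeasurable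
        (.of_forall fun x => hu' _)
    have bd : ∀ u : (Fin (n + 1) → ℝ) → ℝ, Measurable u → (∀ x, u x ∈ Icc (0 : ℝ) 1) → ∀ a,
        (∫ y, u (Fin.cons a y) ∂(Measure.pi fun _ : Fin n => ν)) ∈ Icc (0 : ℝ) 1 := by
      refine fun u hu hu' a => ⟨integral_nonneg fun y => (hu' _).1, ?_⟩
      simpa using integral_mono (int u hu hu' a) (integrable_const (1 : ℝ)) fun y => (hu' _).2
    have anti : ∀ u : (Fin (n + 1) → ℝ) → ℝ, Measurable u → (∀ x, u x ∈ Icc (0 : ℝ) 1) →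
        Antitone u → Antitone fun a => ∫ y, u (Fin.cons a y) ∂(Measure.pi fun _ : Fin n => ν) :=
      fun u hu hu' ha a b hab => integral_mono (int u hu hu' b) (int u hu hu' a) fun y =>
        ha (Fin.cons_le_cons.2 ⟨hab, le_rfl⟩)
    refine (integral_mul_integral_le_of_antitone ν (anti f hfm hf' hf) (anti g hgm hg' hg)
      (bd f hfm hf') (bd g hgm hg')).trans ?_
    refine integral_mono ?_ ?_ fun a => ?_
    · refine Integrable.of_mem_Icc 0 1 ((anti f hfm hf' hf).measurable.mul
        (anti g hgm hg' hg).measurable).aemeasurable (.of_forall fun a => ?_)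
      exact ⟨mul_nonneg (bd f hfm hf' a).1 (bd g hgm hg' a).1,
        mul_le_one₀ (bd f hfm hf' a).2 (bd g hgm hg' a).1 (bd g hgm hg' a).2⟩
    · refine Integrable.of_mem_Icc 0 1 ?_ (.of_forall fun a => bd _ (hfm.mul hgm) hmem a)
      exact (((hfm.mul hgm).comp hcons).stronglyMeasurable.integral_prod_right'
        (ν := Measure.pi fun _ : Fin n => ν)).measurable.aemeasurable
    · exact ih (fun x y hxy => hf (Fin.cons_le_cons.2 ⟨le_rfl, hxy⟩))
        (fun x y hxy => hg (Fin.cons_le_cons.2 ⟨le_rfl, hxy⟩))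
        (hfm.comp (hcons.comp measurable_prodMk_left))
        (hgm.comp (hcons.comp measurable_prodMk_left)) (fun _ => hf' _) (fun _ => hg' _)

/-- The Harris inequality for lower sets. -/
lemma measureReal_mul_le_inter_of_isLowerSet (ν : Measure ℝ) [IsProbabilityMeasure ν] (n : ℕ)
    {A B : Set (Fin n → ℝ)} (hA : IsLowerSet A) (hB : IsLowerSet B)
    (hAm : MeasurableSet A) (hBm : MeasurableSet B) :
    (Measure.pi fun _ => ν).real A * (Measure.pi fun _ => ν).real B
      ≤ (Measure.pi fun _ => ν).real (A ∩ B) := by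
  have anti : ∀ C : Set (Fin n → ℝ), IsLowerSet C →
      Antitone (C.indicator (1 : (Fin n → ℝ) → ℝ)) := by
    intro C hC x y hxy
    by_cases hy : y ∈ C
    · simp [hy, hC hxy hy]
    · simp only [hy, not_false_eq_true, indicator_of_notMem]
      exact indicator_nonneg (fun _ _ => zero_le_one) x
  have mem : ∀ (C : Set (Fin n → ℝ)) x, C.indicator (1 : (Fin n → ℝ) → ℝ) x ∈ Icc (0 : ℝ) 1 := by
    intro C x
    by_cases hx : x ∈ C <;> simp [hx]
  have := integral_mul_integral_le_pi_of_antitone ν n (anti A hA) (anti B hB)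
    (measurable_one.indicator hAm) (measurable_one.indicator hBm) (mem A) (mem B)
  rw [integral_indicator_one hAm, integral_indicator_one hBm] at this
  refine this.trans_eq ?_
  rw [← integral_indicator_one (hAm.inter hBm)]
  simp [inter_indicator_one]

/-- Cramér–Wold: the law of a random vector is determined by the laws of its linear combinations. -/
lemma map_eq_map_of_forall_sum {Ω Ω' : Type*} [MeasurableSpace Ω] [MeasurableSpace Ω']
    {μ : Measure Ω} {ν : Measure Ω'} [IsFiniteMeasure μ] [IsFiniteMeasure ν] {M : ℕ}
    {X : Ω → Fin M → ℝ} {Y : Ω' → Fin M → ℝ} (hX : Measurable X) (hY : Measurable Y)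
    (h : ∀ c : Fin M → ℝ, μ.map (fun ω => ∑ i, c i * X ω i) = ν.map (fun ω => ∑ i, c i * Y ω i)) :
    μ.map X = ν.map Y := by
  refine Measure.ext_of_charFunDual (funext fun L => ?_)
  have hL : ∀ x, L x = ∑ i, L (Pi.single i 1) * x i := by
    intro x
    conv_lhs => rw [pi_eq_sum_univ' x]
    simp [mul_comm, Pi.single]
  rw [charFunDual_eq_charFun_map_one, charFunDual_eq_charFun_map_one,
    Measure.map_map L.continuous.measurable hX, Measure.map_map L.continuous.measurable hY]
  have := h fun i => L (Pi.single i 1)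
  simp_rw [← hL] at this
  exact congrArg (fun m => charFun m 1) this

lemma map_sum_pi_gaussianReal (v : NNReal) {K : ℕ} (d : Fin K → ℝ) :
    (Measure.pi fun _ : Fin K => gaussianReal 0 v).map (fun x => ∑ k, d k * x k)
      = gaussianReal 0 (∑ k, d k ^ 2 * v).toNNReal := by
  have hl : HasGaussianLaw (fun x : Fin K → ℝ => ∑ k, d k * x k)
      (Measure.pi fun _ : Fin K => gaussianReal 0 v) := by
    refine iIndepFun.hasGaussianLaw_fun_sum (fun k => ?_)
      (iIndepFun_pi (X := fun k x => d k * x) fun k => by fun_prop)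
    refine HasGaussianLaw.fun_smul (X := fun x : Fin K → ℝ => x k) (d k) ⟨?_⟩
    rw [(measurePreserving_eval (fun _ : Fin K => gaussianReal 0 v) k).map_eq]
    infer_instance
  rw [hl.map_eq_gaussianReal]
  congr 1
  · rw [integral_finsetSum _ fun k _ => (integrable_eval (μ := fun _ : Fin K => gaussianReal 0 v)
      IsGaussian.integrable_id).const_mul _]
    simp [integral_const_mul, integral_eval]
  · congr 1
    have := variance_sum_pi (μ := fun _ : Fin K => gaussianReal 0 v)
      (X := fun k x => d k * x) fun k => IsGaussian.memLp_two_id.const_mul _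
    have e : (∑ i, fun x : Fin K → ℝ => d i * x i) = fun x => ∑ k, d k * x k := by
      ext x; simp
    rw [e] at this
    rw [this]
    refine Finset.sum_congr rfl fun k _ => ?_
    rw [variance_const_mul]
    exact congrArg _ variance_id_gaussianReal

lemma IsSlepian.map_sum {Ω : Type*} [MeasurableSpace Ω] {μ : Measure Ω} {S : ℝ → Ω → ℝ}
    (hS : IsSlepian μ S) {M : ℕ} (t c : Fin M → ℝ) :
    μ.map (fun ω => ∑ i, c i * S (t i) ω)
      = gaussianReal 0 (∑ i, ∑ j, c i * c j * max 0 (1 - |t i - t j|)).toNNReal := by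
  obtain ⟨hP, hm, -, hg, -, hcov⟩ := hS
  have hLp : ∀ s, MemLp (S s) 2 μ := by
    intro s
    obtain ⟨v, hv⟩ := hg 1 (fun _ => s) (fun _ => 1)
    simp only [Finset.univ_unique, one_mul, Finset.sum_singleton] at hv
    have : MemLp id 2 (μ.map (S s)) := by
      have hv' : μ.map (S s) = gaussianReal 0 v := hv
      rw [hv']
      exact IsGaussian.memLp_two_id
    exact (memLp_map_measure_iff aestronglyMeasurable_id (hm s).aemeasurable).1 this
  obtain ⟨v, hv⟩ := hg M t c
  rw [hv]
  congr 1
  have hms : Measurable fun ω => ∑ i, c i * S (t i) ω := by fun_prop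
  have h1 : ∫ x, x ^ 2 ∂(gaussianReal 0 v) = v := by
    have := variance_id_gaussianReal (μ := 0) (v := v)
    rwa [variance_of_integral_eq_zero aemeasurable_id (by simp)] at this
  rw [← hv, integral_map hms.aemeasurable (by fun_prop)] at h1
  have h2 : ∀ ω, (∑ i, c i * S (t i) ω) ^ 2
      = ∑ i, ∑ j, c i * c j * (S (t i) ω * S (t j) ω) := by
    intro ω
    rw [sq, Finset.sum_mul_sum]
    exact Finset.sum_congr rfl fun i _ => Finset.sum_congr rfl fun j _ => by ring
  simp_rw [h2] at h1
  have hprod : ∀ i j, Integrable (fun ω => c i * c j * (S (t i) ω * S (t j) ω)) μ :=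
    fun i j => ((hLp (t i)).integrable_mul (hLp (t j))).const_mul _
  rw [integral_finsetSum _ fun i _ => integrable_finsetSum _ fun j _ => hprod i j] at h1
  simp_rw [integral_finsetSum _ fun j _ => hprod _ j, integral_const_mul, hcov] at h1
  rw [h1, Real.toNNReal_coe]

/-- The indicator of `l ≤ k < l + N`, as the weights of a moving sum of length `N`. -/
noncomputable def movingWeight (N : ℕ) {M : ℕ} (l : Fin M) (k : Fin (M + N)) : ℝ :=
  if (l : ℕ) ≤ k ∧ (k : ℕ) < l + N then 1 else 0

lemma sum_movingWeight_mul (N : ℕ) {M : ℕ} (l l' : Fin M) :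
    ∑ k, movingWeight N l k * movingWeight N l' k
      = max 0 ((N : ℝ) - |(l : ℝ) - l'|) := by
  have h1 : ∀ k : Fin (M + N), movingWeight N l k * movingWeight N l' k
      = if (k : ℕ) ∈ Finset.Ico (max (l : ℕ) l') (min (l : ℕ) l' + N) then 1 else 0 := by
    intro k
    simp only [movingWeight, Finset.mem_Ico, ite_zero_mul_ite_zero, mul_one]
    congr 1
    simp only [eq_iff_iff]
    omega
  simp_rw [h1]
  rw [Fin.sum_univ_eq_sum_range
    (fun k => if k ∈ Finset.Ico (max (l : ℕ) l') (min (l : ℕ) l' + N) then (1 : ℝ) else 0)]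
  rw [Finset.sum_ite_mem, Finset.inter_eq_right.2, Finset.sum_const, Nat.card_Ico]
  · rcases le_total (l : ℕ) l' with h | h
    · have h' : (l : ℝ) ≤ l' := by exact_mod_cast h
      rw [max_eq_right h, min_eq_left h, abs_of_nonpos (by linarith)]
      rcases le_total (l' : ℕ) (l + N) with h2 | h2
      · have : (l' : ℝ) ≤ l + N := by exact_mod_cast h2
        rw [max_eq_right (by linarith)]
        simp [Nat.cast_sub h2]; ring
      · have : (l : ℝ) + N ≤ l' := by exact_mod_cast h2
        rw [max_eq_left (by linarith), Nat.sub_eq_zero_of_le h2]; simp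
    · have h' : (l' : ℝ) ≤ l := by exact_mod_cast h
      rw [max_eq_left h, min_eq_right h, abs_of_nonneg (by linarith)]
      rcases le_total (l : ℕ) (l' + N) with h2 | h2
      · have : (l : ℝ) ≤ l' + N := by exact_mod_cast h2
        rw [max_eq_right (by linarith)]
        simp [Nat.cast_sub h2]; ring
      · have : (l' : ℝ) + N ≤ l := by exact_mod_cast h2
        rw [max_eq_left (by linarith), Nat.sub_eq_zero_of_le h2]; simp
  · intro k hk
    simp only [Finset.mem_Ico, Finset.mem_range] at *
    omega

/-- On a grid of mesh `1 / N`, the Slepian process is a moving sum of `N` independent Gaussians. -/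
lemma IsSlepian.map_grid {Ω : Type*} [MeasurableSpace Ω] {μ : Measure Ω} {S : ℝ → Ω → ℝ}
    (hS : IsSlepian μ S) {N : ℕ} (hN : 0 < N) (M s : ℕ) :
    μ.map (fun ω (l : Fin M) => S (((s + l : ℕ) : ℝ) / N) ω)
      = (Measure.pi fun _ : Fin (M + N) => gaussianReal 0 (N : NNReal)⁻¹).map
          (fun x l => ∑ k, movingWeight N l k * x k) := by
  have := hS.1
  have hm := hS.2.1
  have hN' : (0 : ℝ) < N := by exact_mod_cast hN
  refine map_eq_map_of_forall_sum (by fun_prop) (by fun_prop) fun c => ?_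
  rw [hS.map_sum]
  have e : ∀ x : Fin (M + N) → ℝ, ∑ l, c l * ∑ k, movingWeight N l k * x k
      = ∑ k, (∑ l, c l * movingWeight N l k) * x k := by
    intro x
    simp_rw [Finset.mul_sum, Finset.sum_mul]
    rw [Finset.sum_comm]
    simp_rw [mul_assoc]
  simp_rw [e]
  rw [map_sum_pi_gaussianReal]
  congr 2
  have e2 : ∀ k : Fin (M + N), (∑ l, c l * movingWeight N l k) ^ 2 * ((N : NNReal)⁻¹ : NNReal)
      = ∑ i, ∑ j, c i * c j * ((movingWeight N i k * movingWeight N j k) * (N : ℝ)⁻¹) := by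
    intro k
    rw [sq, Finset.sum_mul_sum, Finset.sum_mul]
    refine Finset.sum_congr rfl fun i _ => ?_
    rw [Finset.sum_mul]
    refine Finset.sum_congr rfl fun j _ => ?_
    push_cast
    ring
  simp_rw [e2]
  conv_rhs => rw [Finset.sum_comm]
  refine Finset.sum_congr rfl fun i _ => ?_
  conv_rhs => rw [Finset.sum_comm]
  refine Finset.sum_congr rfl fun j _ => ?_
  rw [← Finset.mul_sum, ← Finset.sum_mul, sum_movingWeight_mul,
    max_mul_of_nonneg _ _ (by positivity),
    zero_mul, sub_mul, mul_inv_cancel₀ hN'.ne']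
  congr 3
  rw [← div_eq_mul_inv, ← abs_of_pos hN', ← abs_div, abs_of_pos hN']
  congr 1
  push_cast
  ring

section

variable {Ω : Type*} [MeasurableSpace Ω] {μ : Measure Ω} {S : ℝ → Ω → ℝ}

lemma IsSlepian.measureReal_grid_shift (hS : IsSlepian μ S) {N : ℕ} (hN : 0 < N) (a b : ℕ)
    (h : ℝ) :
    μ.real {ω | ∀ l : ℕ, a ≤ l → l ≤ a + b → S ((l : ℝ) / N) ω ≤ h}
      = μ.real {ω | ∀ l : ℕ, l ≤ b → S ((l : ℝ) / N) ω ≤ h} := by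
  have hm := hS.2.1
  have hC : MeasurableSet {y : Fin (b + 1) → ℝ | ∀ l, y l ≤ h} := by measurability
  have key : ∀ s : ℕ, μ.real {ω | ∀ l : Fin (b + 1), S (((s + l : ℕ) : ℝ) / N) ω ≤ h}
      = (μ.map (fun ω (l : Fin (b + 1)) => S (((s + l : ℕ) : ℝ) / N) ω)).real
          {y | ∀ l, y l ≤ h} := by
    intro s
    rw [map_measureReal_apply (by fun_prop) hC]
    rfl
  have h0 := (key a).trans ((congrArg (fun m => m.real {y : Fin (b + 1) → ℝ | ∀ l, y l ≤ h})
    ((hS.map_grid hN (b + 1) a).trans (hS.map_grid hN (b + 1) 0).symm)).trans (key 0).symm)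
  convert h0 using 3
  · ext ω
    refine ⟨fun H l => H _ (by omega) (by omega), fun H l h1 h2 => ?_⟩
    have := H ⟨l - a, by omega⟩
    rwa [show a + (l - a) = l by omega] at this
  · ext ω
    refine ⟨fun H l => H _ (by omega), fun H l h1 => ?_⟩
    have := H ⟨l, by omega⟩
    rwa [zero_add] at this

lemma IsSlepian.measureReal_grid_mul_le (hS : IsSlepian μ S) {N : ℕ} (hN : 0 < N) (a b : ℕ)
    (h : ℝ) :
    μ.real {ω | ∀ l : ℕ, l ≤ a → S ((l : ℝ) / N) ω ≤ h}
        * μ.real {ω | ∀ l : ℕ, l ≤ b → S ((l : ℝ) / N) ω ≤ h}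
      ≤ μ.real {ω | ∀ l : ℕ, l ≤ a + b → S ((l : ℝ) / N) ω ≤ h} := by
  have hm := hS.2.1
  set Y : (Fin (a + b + 1 + N) → ℝ) → Fin (a + b + 1) → ℝ :=
    fun x l => ∑ k, movingWeight N l k * x k
  have hYm : Measurable Y := by fun_prop
  have hYmono : Monotone Y := fun x y hxy l => Finset.sum_le_sum fun k _ =>
    mul_le_mul_of_nonneg_left (hxy k) (by unfold movingWeight; positivity)
  have hmap := hS.map_grid hN (a + b + 1) 0
  set P := Measure.pi fun _ : Fin (a + b + 1 + N) => gaussianReal 0 (N : NNReal)⁻¹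
  let C : (ℕ → Prop) → Set (Fin (a + b + 1) → ℝ) :=
    fun p => {y | ∀ l : Fin (a + b + 1), p (l : ℕ) → y l ≤ h}
  have hC : ∀ p, MeasurableSet (C p) := by
    intro p
    simp only [C, ofPred_forall]
    exact MeasurableSet.iInter fun l => MeasurableSet.iInter fun _ =>
      measurableSet_le (measurable_pi_apply l) measurable_const
  have key : ∀ p : ℕ → Prop, μ.real {ω | ∀ l : ℕ, l ≤ a + b → p l → S ((l : ℝ) / N) ω ≤ h}
      = P.real (Y ⁻¹' C p) := by
    intro p
    rw [← map_measureReal_apply hYm (hC p), ← hmap, map_measureReal_apply (by fun_prop) (hC p)]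
    congr 1
    ext ω
    simp only [mem_ofPred_eq, zero_add, mem_preimage, C]
    exact ⟨fun H l => H l (by omega), fun H l hl => H ⟨l, by omega⟩⟩
  have lower : ∀ p, IsLowerSet (Y ⁻¹' C p) := fun p x y hyx hx l hl =>
    (hYmono hyx l).trans (hx l hl)
  have fkg := measureReal_mul_le_inter_of_isLowerSet (gaussianReal 0 (N : NNReal)⁻¹) _
    (lower (· ≤ a)) (lower (a ≤ ·)) (hYm (hC (· ≤ a)))
    (hYm (hC (a ≤ ·)))
  have inter : Y ⁻¹' C (· ≤ a) ∩ Y ⁻¹' C (a ≤ ·) = Y ⁻¹' C fun _ => True := by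
    ext x
    simp only [C, mem_inter_iff, mem_preimage, mem_ofPred_eq, forall_const]
    exact ⟨fun H l => (le_total (l : ℕ) a).elim (H.1 l) (H.2 l),
      fun H => ⟨fun l _ => H l, fun l _ => H l⟩⟩
  rw [inter] at fkg
  have prod := (congrArg₂ (· * ·) (key (· ≤ a)) (key (a ≤ ·))).trans_le
    (fkg.trans_eq (key fun _ => True).symm)
  rw [← hS.measureReal_grid_shift hN a b]
  convert prod using 4
  · ext ω
    exact ⟨fun H l _ h2 => H l h2, fun H l h2 => H l (by omega) h2⟩
  · ext ω
    exact ⟨fun H l h1 h2 => H l h2 h1, fun H l h1 h2 => H l h2 h1⟩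
  · simp

lemma forall_Icc_le_iff_dyadic {f : ℝ → ℝ} (hf : Continuous f) {K : ℕ} (hK : 0 < K) (n : ℕ)
    (h : ℝ) :
    (∀ t ∈ Icc (0 : ℝ) (n / K), f t ≤ h)
      ↔ ∀ q l : ℕ, l ≤ n * 2 ^ q → f ((l : ℝ) / (K * 2 ^ q : ℕ)) ≤ h := by
  have hK' : (0 : ℝ) < K := by exact_mod_cast hK
  constructor
  · intro H q l hl
    refine H _ ⟨by positivity, ?_⟩
    have : (l : ℝ) ≤ n * 2 ^ q := by exact_mod_cast hl
    push_cast
    rw [div_le_div_iff₀ (by positivity) hK']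
    nlinarith
  · intro H t ht
    have hN : Tendsto (fun q : ℕ => ((K * 2 ^ q : ℕ) : ℝ)) atTop atTop := by
      push_cast
      exact (tendsto_pow_atTop_atTop_of_one_lt one_lt_two).const_mul_atTop hK'
    have lim : Tendsto (fun q : ℕ => (⌊t * (K * 2 ^ q : ℕ)⌋₊ : ℝ) / (K * 2 ^ q : ℕ)) atTop
        (nhds t) := (tendsto_nat_floor_mul_div_atTop ht.1).comp hN
    refine le_of_tendsto ((hf.tendsto t).comp lim) (.of_forall fun q => H q _ ?_)
    refine Nat.floor_le_of_le ?_
    have := (le_div_iff₀ hK').1 ht.2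
    push_cast
    nlinarith [mul_le_mul_of_nonneg_right this (by positivity : (0 : ℝ) ≤ 2 ^ q)]

lemma IsSlepian.measureReal_le_mul_le (hS : IsSlepian μ S) {K : ℕ} (hK : 0 < K) (a b : ℕ)
    (h : ℝ) :
    μ.real {ω | ∀ t ∈ Icc (0 : ℝ) (a / K), S t ω ≤ h}
        * μ.real {ω | ∀ t ∈ Icc (0 : ℝ) (b / K), S t ω ≤ h}
      ≤ μ.real {ω | ∀ t ∈ Icc (0 : ℝ) ((a + b : ℕ) / K), S t ω ≤ h} := by
  have := hS.1
  have hm := hS.2.1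
  have hc := hS.2.2.1
  let D : ℕ → ℕ → Set Ω := fun n q =>
    {ω | ∀ l : ℕ, l ≤ n * 2 ^ q → S ((l : ℝ) / (K * 2 ^ q : ℕ)) ω ≤ h}
  have hD : ∀ n : ℕ, {ω | ∀ t ∈ Icc (0 : ℝ) (n / K), S t ω ≤ h} = ⋂ q, D n q := by
    intro n
    ext ω
    simp only [mem_ofPred_eq, mem_iInter, D]
    exact forall_Icc_le_iff_dyadic (hc ω) hK n h
  have hDm : ∀ n q, MeasurableSet (D n q) := by
    intro n q
    simp only [D, ofPred_forall]
    exact MeasurableSet.iInter fun l => MeasurableSet.iInter fun _ =>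
      measurableSet_le (hm _) measurable_const
  have anti : ∀ n, Antitone (D n) := by
    refine fun n => antitone_nat_of_succ_le fun q ω H l hl => ?_
    have := H (l * 2) (by rw [pow_succ, ← mul_assoc]; gcongr)
    convert this using 2
    have : (K : ℝ) ≠ 0 := by positivity
    push_cast
    field_simp
    ring
  have lim := (ENNReal.tendsto_toReal (measure_ne_top μ _)).comp
    (tendsto_measure_iInter_atTop (μ := μ) (fun q => (hDm (a + b) q).nullMeasurableSet)
      (anti (a + b)) ⟨0, measure_ne_top _ _⟩)
  rw [hD, hD, hD]
  refine ge_of_tendsto lim (.of_forall fun q => ?_)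
  have := hS.measureReal_grid_mul_le (N := K * 2 ^ q) (by positivity) (a * 2 ^ q) (b * 2 ^ q) h
  rw [← add_mul] at this
  exact (mul_le_mul (measureReal_mono (iInter_subset _ q)) (measureReal_mono (iInter_subset _ q))
    measureReal_nonneg measureReal_nonneg).trans this

lemma IsSlepian.slepF_mul_le (hS : IsSlepian μ S) {K : ℕ} (hK : 0 < K) (a b : ℕ) (h : ℝ) :
    slepF μ S (a / K) h * slepF μ S (b / K) h ≤ slepF μ S ((a + b : ℕ) / K) h := by
  have := hS.1
  have hc := hS.2.2.1
  have lim : ∀ n : ℕ, Tendsto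
      (fun j : ℕ => μ.real {ω | ∀ t ∈ Icc (0 : ℝ) (n / K), S t ω ≤ h - 1 / ((j : ℝ) + 1)})
      atTop (nhds (slepF μ S (n / K) h)) := by
    intro n
    have e : {ω | ∀ t ∈ Icc (0 : ℝ) (n / K), S t ω < h}
        = ⋃ j : ℕ, {ω | ∀ t ∈ Icc (0 : ℝ) (n / K), S t ω ≤ h - 1 / ((j : ℝ) + 1)} := by
      ext ω
      simp only [mem_ofPred_eq, mem_iUnion]
      constructor
      · intro H
        obtain ⟨t₀, ht₀, hmax⟩ := isCompact_Icc.exists_isMaxOn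
          (nonempty_Icc.2 (by positivity : (0 : ℝ) ≤ n / K)) (hc ω).continuousOn
        obtain ⟨j, hj⟩ := exists_nat_one_div_lt (sub_pos.2 (H t₀ ht₀))
        exact ⟨j, fun t ht => (hmax ht).trans (by simp only; linarith)⟩
      · rintro ⟨j, hj⟩ t ht
        have : (0 : ℝ) < 1 / ((j : ℝ) + 1) := by positivity
        linarith [hj t ht]
    rw [slepF, e]
    refine (ENNReal.tendsto_toReal (measure_ne_top μ _)).comp
      (tendsto_measure_iUnion_atTop (μ := μ) fun i j hij ω H t ht => (H t ht).trans ?_)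
    exact sub_le_sub_left (Nat.one_div_le_one_div hij) h
  exact le_of_tendsto_of_tendsto' ((lim a).mul (lim b)) (lim (a + b))
    fun j => hS.measureReal_le_mul_le hK a b _

lemma IsSlepian.slepF_anti (hS : IsSlepian μ S) {T T' : ℝ} (hT : T ≤ T') (h : ℝ) :
    slepF μ S T' h ≤ slepF μ S T h := by
  have := hS.1
  exact measureReal_mono (μ := μ) fun ω H t ht => H t ⟨ht.1, ht.2.trans hT⟩

lemma IsSlepian.exists_slepF_pos (hS : IsSlepian μ S) (h : ℝ) :
    ∃ K : ℕ, 0 < K ∧ 0 < slepF μ S (1 / K) h := by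
  have := hS.1
  by_contra! H
  have hnull : μ {ω | S 0 ω < h} = 0 := by
    refine measure_mono_null (t := ⋃ j : ℕ,
      {ω | ∀ t ∈ Icc (0 : ℝ) (1 / ((j + 1 : ℕ) : ℝ)), S t ω < h}) (fun ω hω => ?_) ?_
    · have ev : ∀ᶠ t in nhds (0 : ℝ), S t ω < h :=
        ((hS.2.2.1 ω).tendsto 0).eventually_lt_const hω
      obtain ⟨ε, hε, hball⟩ := Metric.eventually_nhds_iff.1 ev
      obtain ⟨j, hj⟩ := exists_nat_one_div_lt hε
      refine mem_iUnion.2 ⟨j, fun t ht => hball ?_⟩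
      rw [Real.dist_eq, sub_zero, abs_of_nonneg ht.1]
      push_cast at ht
      exact ht.2.trans_lt hj
    · refine measure_iUnion_null fun j => ?_
      have h0 := (H (j + 1) j.succ_pos).antisymm measureReal_nonneg
      exact (measureReal_eq_zero_iff (measure_ne_top μ _)).1 h0
  have hlaw := hS.map_sum (M := 1) (fun _ => 0) (fun _ => 1)
  simp only [Finset.univ_unique, one_mul, Finset.sum_singleton, sub_self, abs_zero, sub_zero,
    zero_le_one, sup_of_le_right, Real.toNNReal_one] at hlaw
  have hg : gaussianReal 0 1 (Iio h) = 0 := by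
    rw [← hlaw, Measure.map_apply (hS.2.1 0) measurableSet_Iio]
    exact hnull
  have := gaussianReal_absolutelyContinuous' 0 one_ne_zero hg
  simp at this

end

theorem shepp_constant_exists {Ω : Type*} [MeasurableSpace Ω] (μ : Measure Ω)
    (S : ℝ → Ω → ℝ) (hS : IsSlepian μ S) (h : ℝ) :
    ∃ L : ℝ, Filter.Tendsto (fun T : ℝ => -(1 / T) * Real.log (slepF μ S T h))
      Filter.atTop (nhds L) := by
  have := hS.1
  obtain ⟨K, hK, hpos⟩ := hS.exists_slepF_pos h
  have hK' : (0 : ℝ) < K := by exact_mod_cast hK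
  have hF : ∀ n : ℕ, 0 < slepF μ S (n / K) h := by
    intro n
    induction n with
    | zero => exact hpos.trans_le (hS.slepF_anti (by simp) h)
    | succ n ih =>
      have := hS.slepF_mul_le hK n 1 h
      rw [Nat.cast_one] at this
      exact (mul_pos ih hpos).trans_le this
  set u : ℕ → ℝ := fun n => -Real.log (slepF μ S (n / K) h) with hu
  have hsub : Subadditive u := by
    intro m n
    have := Real.log_le_log (mul_pos (hF m) (hF n)) (hS.slepF_mul_le hK m n h)
    rw [Real.log_mul (hF m).ne' (hF n).ne'] at this
    simp only [hu]
    linarith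
  have hu0 : ∀ n, 0 ≤ u n := fun n =>
    neg_nonneg.2 (Real.log_nonpos (hF n).le measureReal_le_one)
  have hlim := hsub.tendsto_lim ⟨0, by
    rintro _ ⟨n, rfl⟩
    exact div_nonneg (hu0 n) n.cast_nonneg⟩
  have hfloor : Tendsto (fun T : ℝ => ⌊(K : ℝ) * T⌋₊) atTop atTop :=
    tendsto_nat_floor_atTop.comp (tendsto_id.const_mul_atTop hK')
  have hratio : Tendsto (fun T : ℝ => (⌊(K : ℝ) * T⌋₊ : ℝ) / T) atTop (nhds K) :=
    tendsto_nat_floor_mul_div_atTop hK'.le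
  have hratio' : Tendsto (fun T : ℝ => ((⌊(K : ℝ) * T⌋₊ + 1 : ℕ) : ℝ) / T) atTop (nhds K) := by
    have := hratio.add (tendsto_inv_atTop_zero (𝕜 := ℝ))
    rw [add_zero] at this
    refine this.congr fun T => ?_
    push_cast
    ring
  refine ⟨hsub.lim * K, tendsto_of_tendsto_of_tendsto_of_le_of_le'
    ((hlim.comp hfloor).mul hratio)
    ((hlim.comp ((tendsto_add_atTop_nat 1).comp hfloor)).mul hratio') ?_ ?_⟩
  · filter_upwards [eventually_gt_atTop 0, hfloor.eventually_gt_atTop 0] with T hT hn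
    have hn' : (0 : ℝ) < ⌊(K : ℝ) * T⌋₊ := by exact_mod_cast hn
    have hle : slepF μ S T h ≤ slepF μ S ((⌊(K : ℝ) * T⌋₊ : ℕ) / K) h :=
      hS.slepF_anti ((div_le_iff₀' hK').2 (Nat.floor_le (by positivity))) h
    have hTpos : 0 < slepF μ S T h := (hF (⌊(K : ℝ) * T⌋₊ + 1)).trans_le
      (hS.slepF_anti ((le_div_iff₀' hK').2 (by exact_mod_cast (Nat.lt_floor_add_one _).le)) h)
    have := Real.log_le_log hTpos hle
    simp only [Function.comp_apply]
    rw [div_mul_div_cancel₀ hn'.ne', neg_mul, ← mul_neg, one_div_mul_eq_div]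
    exact div_le_div_of_nonneg_right (neg_le_neg this) hT.le
  · filter_upwards [eventually_gt_atTop 0] with T hT
    have hn' : (0 : ℝ) < (⌊(K : ℝ) * T⌋₊ + 1 : ℕ) := by positivity
    have hle : slepF μ S ((⌊(K : ℝ) * T⌋₊ + 1 : ℕ) / K) h ≤ slepF μ S T h :=
      hS.slepF_anti ((le_div_iff₀' hK').2 (by exact_mod_cast (Nat.lt_floor_add_one _).le)) h
    have := Real.log_le_log (hF _) hle
    simp only [Function.comp_apply]
    rw [div_mul_div_cancel₀ hn'.ne', neg_mul, ← mul_neg, one_div_mul_eq_div]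
    exact div_le_div_of_nonneg_right (neg_le_neg this) hT.le
end

section
/- For every real h and every positive integer n, the Shepp constant Λ(h) satisfies −(1/(n+1)) log F_n(h) ≤ Λ(h) ≤ −(1/n) log F_n(h). -/
open MeasureTheory ProbabilityTheory Real Set Filter

open scoped ENNReal Topology

/-- A measure on a preordered space is associated if any two antitone nonnegative observables are
nonnegatively correlated. -/
def IsAssociated {α : Type*} [Preorder α] [MeasurableSpace α] (μ : Measure α) : Prop :=
  ∀ f g : α → ℝ≥0∞, Antitone f → Antitone g → Measurable f → Measurable g →
    (∫⁻ x, f x ∂μ) * (∫⁻ x, g x ∂μ) ≤ ∫⁻ x, f x * g x ∂μ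

theorem ENNReal.mul_add_mul_le_of_le {a b c d : ℝ≥0∞} (hab : a ≤ b) (hcd : c ≤ d) :
    a * d + b * c ≤ a * c + b * d := by
  obtain ⟨e, rfl⟩ := exists_add_of_le hcd
  calc a * (c + e) + b * c = a * c + b * c + a * e := by ring
    _ ≤ a * c + b * c + b * e := by gcongr
    _ = a * c + b * (c + e) := by ring

/-- **Chebyshev's association inequality**. -/
theorem isAssociated_of_linearOrder {α : Type*} [LinearOrder α] [MeasurableSpace α]
    (μ : Measure α) [IsProbabilityMeasure μ] : IsAssociated μ := by
  intro f g hf hg mf mg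
  have mfg : Measurable fun x => f x * g x := mf.mul mg
  have key : ∀ x y, f x * g y + f y * g x ≤ f x * g x + f y * g y := by
    intro x y
    rcases le_total x y with h | h
    · have := ENNReal.mul_add_mul_le_of_le (hf h) (hg h)
      rw [add_comm (f x * g y), add_comm (f x * g x)]
      exact this
    · exact ENNReal.mul_add_mul_le_of_le (hf h) (hg h)
  have hle : ∫⁻ x, ∫⁻ y, (f x * g y + f y * g x) ∂μ ∂μ
      ≤ ∫⁻ x, ∫⁻ y, (f x * g x + f y * g y) ∂μ ∂μ :=
    lintegral_mono fun x => lintegral_mono fun y => key x y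
  have h1 : ∫⁻ x, ∫⁻ y, (f x * g y + f y * g x) ∂μ ∂μ
      = 2 * ((∫⁻ x, f x ∂μ) * (∫⁻ x, g x ∂μ)) := by
    have : ∀ x, ∫⁻ y, (f x * g y + f y * g x) ∂μ
        = f x * (∫⁻ y, g y ∂μ) + (∫⁻ y, f y ∂μ) * g x := fun x => by
      rw [lintegral_add_left (mg.const_mul _), lintegral_const_mul _ mg,
        lintegral_mul_const _ mf]
    simp_rw [this]
    rw [lintegral_add_left (mf.mul_const _), lintegral_const_mul _ mg,
        lintegral_mul_const _ mf, two_mul]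
  have h2 : ∫⁻ x, ∫⁻ y, (f x * g x + f y * g y) ∂μ ∂μ = 2 * ∫⁻ x, f x * g x ∂μ := by
    have : ∀ x, ∫⁻ y, (f x * g x + f y * g y) ∂μ = f x * g x + ∫⁻ y, f y * g y ∂μ := fun x => by
      rw [lintegral_add_left measurable_const]
      simp
    simp_rw [this]
    rw [lintegral_add_left mfg]
    simp [two_mul]
  rw [h1, h2] at hle
  exact (ENNReal.mul_le_mul_iff_right two_ne_zero ENNReal.ofNat_ne_top).1 hle

theorem IsAssociated.map {α β : Type*} [Preorder α] [MeasurableSpace α] [Preorder β]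
    [MeasurableSpace β] {μ : Measure α} (hμ : IsAssociated μ) {φ : α → β} (hφ : Monotone φ)
    (mφ : Measurable φ) : IsAssociated (μ.map φ) := by
  intro f g hf hg mf mg
  have mfg : Measurable fun x => f x * g x := mf.mul mg
  rw [lintegral_map mf mφ, lintegral_map mg mφ, lintegral_map mfg mφ]
  exact hμ _ _ (hf.comp_monotone hφ) (hg.comp_monotone hφ) (mf.comp mφ) (mg.comp mφ)

theorem IsAssociated.prod {α β : Type*} [Preorder α] [MeasurableSpace α] [Preorder β]
    [MeasurableSpace β] {μ : Measure α} {ν : Measure β} [SFinite ν]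
    (hμ : IsAssociated μ) (hν : IsAssociated ν) : IsAssociated (μ.prod ν) := by
  intro f g hf hg mf mg
  have mfg : Measurable fun x => f x * g x := mf.mul mg
  rw [lintegral_prod _ mf.aemeasurable, lintegral_prod _ mg.aemeasurable,
    lintegral_prod _ mfg.aemeasurable]
  refine (hμ _ _ (fun x y hxy => ?_) (fun x y hxy => ?_) mf.lintegral_prod_right'
    mg.lintegral_prod_right').trans (lintegral_mono fun x => ?_)
  · exact lintegral_mono fun z => hf ⟨hxy, le_rfl⟩
  · exact lintegral_mono fun z => hg ⟨hxy, le_rfl⟩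
  · exact hν _ _ (fun y z hyz => hf ⟨le_rfl, hyz⟩) (fun y z hyz => hg ⟨le_rfl, hyz⟩)
      (mf.comp measurable_prodMk_left) (mg.comp measurable_prodMk_left)

/-- **Harris inequality**: a finite product of probability measures on linear orders is
associated. -/
theorem isAssociated_pi {α : Type*} [LinearOrder α] [MeasurableSpace α] (ν : Measure α)
    [IsProbabilityMeasure ν] (n : ℕ) : IsAssociated (Measure.pi fun _ : Fin n => ν) := by
  induction n with
  | zero =>
    intro f g hf hg mf mg
    have h : ∀ u : (Fin 0 → α) → ℝ≥0∞, u = fun _ => u default :=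
      fun u => funext fun x => congrArg u (Subsingleton.elim _ _)
    rw [h f, h g]
    simp
  | succ n ih =>
    have hp := (measurePreserving_piFinSuccAbove (fun _ : Fin (n + 1) => ν) 0).symm
    rw [← hp.map_eq]
    refine ((isAssociated_of_linearOrder ν).prod ih).map (fun x y hxy => ?_) hp.measurable
    intro i
    refine Fin.cases ?_ (fun j => ?_) i
    · exact hxy.1
    · exact hxy.2 j

theorem ContinuousLinearMap.apply_eq_sum_single_mul {ι : Type*} [Fintype ι] [DecidableEq ι]
    (L : (ι → ℝ) →L[ℝ] ℝ) (x : ι → ℝ) : L x = ∑ i, L (Pi.single i 1) * x i := by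
  conv_lhs => rw [← Finset.univ_sum_single x, map_sum]
  refine Finset.sum_congr rfl fun i _ => ?_
  have : (Pi.single i (x i) : ι → ℝ) = x i • Pi.single i 1 := by
    rw [← Pi.single_smul]; simp
  rw [this, map_smul, smul_eq_mul, mul_comm]

/-- Two Gaussian vectors with the same means and covariances have the same law. -/
theorem HasGaussianLaw.map_eq_map {ι Ω Ω' : Type*} [Fintype ι] {mΩ : MeasurableSpace Ω}
    {mΩ' : MeasurableSpace Ω'} {P : Measure Ω} {P' : Measure Ω'} {X : ι → Ω → ℝ}
    {Y : ι → Ω' → ℝ} (hX : HasGaussianLaw (fun ω => (X · ω)) P)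
    (hY : HasGaussianLaw (fun ω => (Y · ω)) P') (hmean : ∀ i, P[X i] = P'[Y i])
    (hcov : ∀ i j, cov[X i, X j; P] = cov[Y i, Y j; P']) :
    P.map (fun ω => (X · ω)) = P'.map (fun ω => (Y · ω)) := by
  classical
  have := hX.isProbabilityMeasure
  have := hY.isProbabilityMeasure
  have := hX.isGaussian_map
  have := hY.isGaussian_map
  refine Measure.ext_of_charFunDual (funext fun L => ?_)
  rw [hX.charFunDual_map_eq, hY.charFunDual_map_eq]
  have eX : (L ∘ fun ω => (X · ω)) = fun ω => ∑ i, L (Pi.single i 1) * X i ω :=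
    funext fun ω => L.apply_eq_sum_single_mul _
  have eY : (L ∘ fun ω => (Y · ω)) = fun ω => ∑ i, L (Pi.single i 1) * Y i ω :=
    funext fun ω => L.apply_eq_sum_single_mul _
  have mX : ∀ i, MemLp (fun ω => L (Pi.single i 1) * X i ω) 2 P :=
    fun i => (hX.eval i).memLp_two.const_mul _
  have mY : ∀ i, MemLp (fun ω => L (Pi.single i 1) * Y i ω) 2 P' :=
    fun i => (hY.eval i).memLp_two.const_mul _
  have hE : P[L ∘ fun ω => (X · ω)] = P'[L ∘ fun ω => (Y · ω)] := by
    rw [eX, eY, integral_finsetSum _ fun i _ => (mX i).integrable one_le_two,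
      integral_finsetSum _ fun i _ => (mY i).integrable one_le_two]
    simp_rw [integral_const_mul, hmean]
  have hV : Var[L ∘ fun ω => (X · ω); P] = Var[L ∘ fun ω => (Y · ω); P'] := by
    rw [eX, eY, ← covariance_self, ← covariance_self, covariance_fun_sum_fun_sum mX mX,
      covariance_fun_sum_fun_sum mY mY]
    · simp_rw [covariance_const_mul_left, covariance_const_mul_right, hcov]
    · exact Finset.aemeasurable_fun_sum _ fun i _ => (mY i).aestronglyMeasurable.aemeasurable
    · exact Finset.aemeasurable_fun_sum _ fun i _ => (mX i).aestronglyMeasurable.aemeasurable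
  rw [hE, hV]

namespace IsSlepian

variable {Ω : Type*} [MeasurableSpace Ω] {μ : Measure Ω} {S : ℝ → Ω → ℝ}

theorem hasGaussianLaw (hS : IsSlepian μ S) {ι : Type*} [Fintype ι] (t : ι → ℝ) :
    HasGaussianLaw (fun ω i => S (t i) ω) μ := by
  obtain ⟨-, hm, -, hG, -, -⟩ := hS
  refine ⟨isGaussian_of_map_eq_gaussianReal fun L => ?_⟩
  classical
  obtain ⟨v, hv⟩ := hG (Fintype.card ι) (fun k => t ((Fintype.equivFin ι).symm k))
    (fun k => L (Pi.single ((Fintype.equivFin ι).symm k) 1))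
  refine ⟨0, v, ?_⟩
  rw [Measure.map_map L.continuous.measurable (measurable_pi_lambda _ fun i => hm (t i)), ← hv]
  congr 1
  ext ω
  rw [Function.comp_apply, L.apply_eq_sum_single_mul]
  exact (Equiv.sum_comp (Fintype.equivFin ι).symm
    (fun i => L (Pi.single i 1) * S (t i) ω)).symm

theorem isGaussianProcess (hS : IsSlepian μ S) : IsGaussianProcess S μ :=
  ⟨fun _ => hS.hasGaussianLaw _⟩

theorem memLp_two (hS : IsSlepian μ S) (t : ℝ) : MemLp (S t) 2 μ :=
  (hS.isGaussianProcess.hasGaussianLaw_eval t).memLp_two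

theorem covariance_eq (hS : IsSlepian μ S) (s t : ℝ) :
    cov[S s, S t; μ] = max 0 (1 - |s - t|) := by
  have := hS.1
  rw [covariance_eq_sub (hS.memLp_two s) (hS.memLp_two t), hS.2.2.2.2.1 s]
  simpa using hS.2.2.2.2.2 s t

/-- The law of the process on an index set is invariant under translations. -/
theorem map_shift_eq (hS : IsSlepian μ S) (I : Set ℝ) (a : ℝ) :
    μ.map (fun ω (u : I) => S (a + u) ω) = μ.map (fun ω (u : I) => S u ω) := by
  have := hS.1
  refine (map_eq_iff_forall_finset_map_restrict_eq (X := fun (u : I) ω => S (a + u) ω)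
    (Y := fun (u : I) ω => S u ω)
    (measurable_pi_lambda _ fun u => hS.2.1 _).aemeasurable
    (measurable_pi_lambda _ fun u => hS.2.1 _).aemeasurable).2 fun J => ?_
  refine HasGaussianLaw.map_eq_map (X := fun (i : J) ω => S (a + i) ω)
    (Y := fun (i : J) ω => S i ω) ?_ ?_ ?_ ?_
  · exact (hS.isGaussianProcess.comp_right (fun u : I => a + (u : ℝ))).hasGaussianLaw J
  · exact (hS.isGaussianProcess.comp_right (fun u : I => (u : ℝ))).hasGaussianLaw J
  · intro i
    rw [hS.2.2.2.2.1, hS.2.2.2.2.1]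
  · intro i j
    rw [hS.covariance_eq, hS.covariance_eq, add_sub_add_left_eq_sub]

/-- The restrictions of the process to index sets at distance at least one are independent. -/
theorem indepFun_of_one_le_abs_sub (hS : IsSlepian μ S) {I J : Set ℝ}
    (hIJ : ∀ s ∈ I, ∀ t ∈ J, 1 ≤ |s - t|) :
    IndepFun (fun ω (u : I) => S u ω) (fun ω (u : J) => S u ω) μ := by
  refine IsGaussianProcess.indepFun_of_covariance_eq_zero (X := fun (u : I) => S u)
    (Y := fun (u : J) => S u) ?_ (fun s => (hS.2.1 _).aemeasurable)
    (fun s => (hS.2.1 _).aemeasurable) fun s t => ?_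
  · have h := hS.isGaussianProcess.comp_right
      (Sum.elim (fun u : I => (u : ℝ)) (fun u : J => (u : ℝ)))
    rwa [Sum.comp_elim] at h
  · rw [hS.covariance_eq]
    exact max_eq_left (by linarith [hIJ s s.2 t t.2])

end IsSlepian

theorem sum_window_mul_window (M N i j : ℕ) (hi : i < N) :
    ∑ k : Fin (N + M), (if i ≤ k ∧ (k : ℕ) < i + M then (1 : ℝ) else 0) *
      (if j ≤ k ∧ (k : ℕ) < j + M then 1 else 0) = max 0 ((M : ℝ) - |(i : ℝ) - j|) := by
  rw [Fin.sum_univ_eq_sum_range (fun k => (if i ≤ k ∧ k < i + M then (1 : ℝ) else 0) *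
    (if j ≤ k ∧ k < j + M then 1 else 0)) (N + M)]
  simp_rw [ite_zero_mul_ite_zero, mul_one]
  rw [Finset.sum_boole]
  have : (Finset.range (N + M)).filter
      (fun k => (i ≤ k ∧ k < i + M) ∧ j ≤ k ∧ k < j + M) =
      Finset.Ico (max i j) (min i j + M) := by
    ext k
    simp only [Finset.mem_filter, Finset.mem_range, Finset.mem_Ico]
    omega
  rw [this, Nat.card_Ico]
  rcases le_total i j with h | h
  · have h' : (i : ℝ) ≤ j := by exact_mod_cast h
    rw [max_eq_right h, min_eq_left h, abs_of_nonpos (by linarith)]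
    rcases le_total j (i + M) with h2 | h2
    · have : (j : ℝ) ≤ i + M := by exact_mod_cast h2
      rw [Nat.cast_sub h2, max_eq_right (by linarith)]
      push_cast; ring
    · have : (i : ℝ) + M ≤ j := by exact_mod_cast h2
      rw [Nat.sub_eq_zero_of_le h2, max_eq_left (by linarith)]
      simp
  · have h' : (j : ℝ) ≤ i := by exact_mod_cast h
    rw [max_eq_left h, min_eq_right h, abs_of_nonneg (by linarith)]
    rcases le_total i (j + M) with h2 | h2
    · have : (i : ℝ) ≤ j + M := by exact_mod_cast h2
      rw [Nat.cast_sub h2, max_eq_right (by linarith)]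
      push_cast; ring
    · have : (j : ℝ) + M ≤ i := by exact_mod_cast h2
      rw [Nat.sub_eq_zero_of_le h2, max_eq_left (by linarith)]
      simp

/-- The values of a Slepian process on a grid have the law of moving sums of independent Gaussian
variables, hence are associated. -/
theorem IsSlepian.isAssociated_grid {Ω : Type*} [MeasurableSpace Ω] {μ : Measure Ω}
    {S : ℝ → Ω → ℝ} (hS : IsSlepian μ S) {M : ℕ} (hM : 0 < M) (N : ℕ) :
    IsAssociated (μ.map fun ω (i : Fin N) => S ((i : ℕ) / M) ω) := by
  have hM' : (0 : ℝ) < M := by exact_mod_cast hM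
  set ν : Measure ℝ := gaussianReal 0 (M : NNReal)⁻¹ with hν
  set Q : Measure (Fin (N + M) → ℝ) := Measure.pi fun _ => ν with hQ
  let a : Fin N → Fin (N + M) → ℝ := fun i k =>
    if (i : ℕ) ≤ k ∧ (k : ℕ) < i + M then 1 else 0
  let A : (Fin (N + M) → ℝ) →L[ℝ] (Fin N → ℝ) :=
    LinearMap.toContinuousLinearMap (Matrix.mulVecLin (Matrix.of a))
  have hA : ∀ x i, A x i = ∑ k, a i k * x k := fun x i => rfl
  have hmono : Monotone A := fun x y hxy i => by
    rw [hA, hA]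
    refine Finset.sum_le_sum fun k _ => mul_le_mul_of_nonneg_left (hxy k) ?_
    simp only [a]; split_ifs <;> norm_num
  have hind : iIndepFun (fun (k : Fin (N + M)) (x : Fin (N + M) → ℝ) => x k) Q :=
    iIndepFun_pi (X := fun _ x => x) fun _ => aemeasurable_id
  have hmp : ∀ k, MeasurePreserving (fun x : Fin (N + M) → ℝ => x k) Q ν :=
    fun k => measurePreserving_eval (fun _ => ν) k
  have hg : ∀ k, HasGaussianLaw (fun x : Fin (N + M) → ℝ => x k) Q := fun k =>
    ⟨by rw [(hmp k).map_eq]; infer_instance⟩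
  have hgl : HasGaussianLaw (fun x : Fin (N + M) → ℝ => (fun k => x k)) Q :=
    iIndepFun.hasGaussianLaw hg hind
  have hAg : HasGaussianLaw (fun x => A x) Q := hgl.map_fun A
  have hcovx : ∀ k l, cov[fun x : Fin (N + M) → ℝ => x k, fun x => x l; Q]
      = if k = l then (M : ℝ)⁻¹ else 0 := by
    intro k l
    split_ifs with h
    · subst h
      rw [covariance_self (hmp k).aemeasurable]
      have := variance_map (X := fun x : ℝ => x) (Y := fun x : Fin (N + M) → ℝ => x k) (μ := Q)
        (by fun_prop) (hmp k).aemeasurable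
      rw [(hmp k).map_eq, hν, variance_fun_id_gaussianReal] at this
      rw [show (fun x : Fin (N + M) → ℝ => x k) = (fun x : ℝ => x) ∘ fun x => x k from rfl, ← this]
      simp
    · exact (hind.indepFun h).covariance_eq_zero (hg k).memLp_two (hg l).memLp_two
  have hEx : ∀ k, Q[fun x : Fin (N + M) → ℝ => x k] = 0 := fun k => by
    have := integral_map (hmp k).aemeasurable (f := fun y : ℝ => y) aestronglyMeasurable_id
    rw [(hmp k).map_eq, hν, integral_id_gaussianReal] at this
    exact this.symm
  have mX : ∀ (i : Fin N) (k), MemLp (fun x : Fin (N + M) → ℝ => a i k * x k) 2 Q :=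
    fun i k => (hg k).memLp_two.const_mul _
  have hlaw : μ.map (fun ω (i : Fin N) => S ((i : ℕ) / M) ω) = Q.map fun x => A x := by
    refine HasGaussianLaw.map_eq_map (X := fun (i : Fin N) ω => S ((i : ℕ) / M) ω)
      (Y := fun i x => A x i) ?_ hAg (fun i => ?_) fun i j => ?_
    · exact hS.hasGaussianLaw _
    · rw [hS.2.2.2.2.1]
      simp_rw [hA]
      rw [integral_finsetSum _ fun k _ => (mX i k).integrable one_le_two]
      simp_rw [integral_const_mul, hEx]
      simp
    · rw [hS.covariance_eq]
      simp_rw [hA]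
      rw [covariance_fun_sum_fun_sum (mX i) (mX j)]
      simp_rw [covariance_const_mul_left, covariance_const_mul_right, hcovx]
      have := sum_window_mul_window M N i j i.2
      simp only [mul_ite, mul_zero, Finset.sum_ite_eq, Finset.mem_univ, if_true]
      simp_rw [← mul_assoc]
      rw [← Finset.sum_mul, this, max_mul_of_nonneg _ _ (inv_nonneg.2 hM'.le), zero_mul, ← sub_div,
        abs_div, abs_of_pos hM']
      congr 1
      field_simp
  rw [hlaw]
  exact (isAssociated_pi ν (N + M)).map hmono A.continuous.measurable

/-- Staying strictly below a level on a compact index set is a measurable event, when tested on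
continuous paths. -/
theorem exists_measurableSet_forall_lt {K : Type*} [TopologicalSpace K] [CompactSpace K]
    [TopologicalSpace.SeparableSpace K] [Nonempty K] (h : ℝ) :
    ∃ U : Set (K → ℝ), MeasurableSet U ∧ ∀ f : K → ℝ, Continuous f → (f ∈ U ↔ ∀ t, f t < h) := by
  refine ⟨⋃ k : ℕ, ⋂ n : ℕ, {x | x (TopologicalSpace.denseSeq K n) ≤ h - 1 / ((k : ℝ) + 1)},
    MeasurableSet.iUnion fun k => MeasurableSet.iInter fun n =>
      measurableSet_le (measurable_pi_apply _) measurable_const, fun f hf => ?_⟩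
  simp only [mem_iUnion, mem_iInter, mem_ofPred_eq]
  constructor
  · rintro ⟨k, hk⟩ t
    have hcl : IsClosed {t | f t ≤ h - 1 / ((k : ℝ) + 1)} := isClosed_le hf continuous_const
    have := hcl.closure_subset_iff.2 (range_subset_iff.2 hk)
      ((TopologicalSpace.denseRange_denseSeq K).closure_range ▸ mem_univ t)
    have hk' : (0 : ℝ) < 1 / ((k : ℝ) + 1) := Nat.one_div_pos_of_nat
    simp only [mem_ofPred_eq] at this
    linarith
  · intro H
    obtain ⟨t, -, ht⟩ := isCompact_univ.exists_isMaxOn univ_nonempty hf.continuousOn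
    obtain ⟨k, hk⟩ := exists_nat_one_div_lt (sub_pos.2 (H t))
    exact ⟨k, fun n => (show f _ ≤ f t from ht (mem_univ _)).trans (by linarith)⟩

theorem le_measure_of_forall_frequently_mem {Ω : Type*} [MeasurableSpace Ω] {μ : Measure Ω}
    [IsFiniteMeasure μ] {G : ℕ → Set Ω} (hG : ∀ r, MeasurableSet (G r)) {H : Set Ω} {a : ℝ≥0∞}
    (ha : ∀ r, a ≤ μ (G r)) (hH : ∀ ω, (∃ᶠ r in atTop, ω ∈ G r) → ω ∈ H) : a ≤ μ H := by
  have ht := tendsto_measure_iInter_atTop (μ := μ) (s := fun n : ℕ => ⋃ r ≥ n, G r)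
    (fun n => (MeasurableSet.iUnion fun r => MeasurableSet.iUnion fun _ => hG r).nullMeasurableSet)
    (fun m n hmn => biUnion_mono (fun r hr => le_trans hmn hr) fun _ _ => le_rfl)
    ⟨0, measure_ne_top _ _⟩
  refine (ge_of_tendsto' ht fun n => (ha n).trans (measure_mono ?_)).trans
    (measure_mono fun ω hω => hH ω ?_)
  · exact fun ω hω => mem_iUnion₂.2 ⟨n, le_rfl, hω⟩
  · simp only [mem_iInter, mem_iUnion, exists_prop] at hω
    exact frequently_atTop.2 hω

namespace IsSlepian

variable {Ω : Type*} [MeasurableSpace Ω] {μ : Measure Ω} {S : ℝ → Ω → ℝ}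

theorem measure_forall_lt_shift (hS : IsSlepian μ S) (a h : ℝ) {t : ℝ} (ht : 0 ≤ t) :
    μ {ω | ∀ u ∈ Icc a (a + t), S u ω < h} = μ {ω | ∀ u ∈ Icc 0 t, S u ω < h} := by
  have : Nonempty (Icc 0 t) := ⟨⟨0, le_rfl, ht⟩⟩
  obtain ⟨U, mU, hU⟩ := exists_measurableSet_forall_lt (K := Icc 0 t) h
  have hlaw := congrArg (fun ν => ν U) (hS.map_shift_eq (Icc 0 t) a)
  rw [Measure.map_apply (measurable_pi_lambda _ fun u => hS.2.1 _) mU,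
    Measure.map_apply (measurable_pi_lambda _ fun u => hS.2.1 _) mU] at hlaw
  convert hlaw using 2
  · ext ω
    have hc : Continuous fun u : Icc 0 t => S (a + u) ω :=
      (hS.2.2.1 ω).comp (by fun_prop : Continuous fun u : Icc 0 t => a + (u : ℝ))
    rw [mem_preimage, hU _ hc]
    constructor
    · exact fun H u => H _ ⟨by linarith [u.2.1], by linarith [u.2.2]⟩
    · intro H u hu
      have := H ⟨u - a, by linarith [hu.1], by linarith [hu.2]⟩
      simpa using this
  · ext ω
    have hc : Continuous fun u : Icc 0 t => S u ω := (hS.2.2.1 ω).comp continuous_subtype_val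
    rw [mem_preimage, hU _ hc]
    exact ⟨fun H u => H u u.2, fun H u hu => H ⟨u, hu⟩⟩

theorem measure_forall_lt_le_mul (hS : IsSlepian μ S) (h : ℝ) {s t : ℝ} (hs : 0 ≤ s)
    (ht : 0 ≤ t) :
    μ {ω | ∀ u ∈ Icc 0 (s + 1 + t), S u ω < h} ≤
      μ {ω | ∀ u ∈ Icc 0 s, S u ω < h} * μ {ω | ∀ u ∈ Icc 0 t, S u ω < h} := by
  rw [← hS.measure_forall_lt_shift (s + 1) h ht]
  set I := Icc 0 s
  set J := Icc (s + 1) (s + 1 + t)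
  have : Nonempty I := ⟨⟨0, le_rfl, hs⟩⟩
  have : Nonempty J := ⟨⟨s + 1, le_rfl, by linarith⟩⟩
  obtain ⟨U, mU, hU⟩ := exists_measurableSet_forall_lt (K := I) h
  obtain ⟨V, mV, hV⟩ := exists_measurableSet_forall_lt (K := J) h
  have hind := hS.indepFun_of_one_le_abs_sub (I := I) (J := J) fun x hx y hy => by
    rw [abs_sub_comm]
    exact le_trans (by linarith [hx.2, hy.1]) (le_abs_self _)
  have hprod := hind.measure_inter_preimage_eq_mul _ _ mU mV
  have eU : (fun ω (u : I) => S u ω) ⁻¹' U = {ω | ∀ u ∈ I, S u ω < h} := by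
    ext ω
    have hc : Continuous fun u : I => S u ω := (hS.2.2.1 ω).comp continuous_subtype_val
    rw [mem_preimage, hU _ hc]
    exact Subtype.forall
  have eV : (fun ω (u : J) => S u ω) ⁻¹' V = {ω | ∀ u ∈ J, S u ω < h} := by
    ext ω
    have hc : Continuous fun u : J => S u ω := (hS.2.2.1 ω).comp continuous_subtype_val
    rw [mem_preimage, hV _ hc]
    exact Subtype.forall
  rw [eU, eV] at hprod
  rw [← hprod]
  exact measure_mono fun ω hω =>
    ⟨fun u hu => hω u ⟨hu.1, by linarith [hu.2]⟩, fun u hu => hω u ⟨by linarith [hu.1], hu.2⟩⟩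

theorem measure_grid_mul_le (hS : IsSlepian μ S) {M : ℕ} (hM : 0 < M) (N : ℕ) (c : ℝ)
    (p : Fin N → Prop) :
    μ {ω | ∀ i : Fin N, p i → S ((i : ℕ) / M) ω ≤ c} *
        μ {ω | ∀ i : Fin N, ¬ p i → S ((i : ℕ) / M) ω ≤ c} ≤
      μ {ω | ∀ i : Fin N, S ((i : ℕ) / M) ω ≤ c} := by
  have hX : Measurable fun ω (i : Fin N) => S ((i : ℕ) / M) ω :=
    measurable_pi_lambda _ fun _ => hS.2.1 _
  let B : (Fin N → Prop) → Set (Fin N → ℝ) := fun q => {x | ∀ i, q i → x i ≤ c}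
  have mB : ∀ q, MeasurableSet (B q) := fun q => by
    have : B q = ⋂ i, ⋂ _ : q i, {x | x i ≤ c} := by ext; simp [B]
    rw [this]
    exact MeasurableSet.iInter fun i => MeasurableSet.iInter fun _ =>
      measurableSet_le (measurable_pi_apply _) measurable_const
  have hB : ∀ q, Antitone ((B q).indicator (1 : (Fin N → ℝ) → ℝ≥0∞)) := fun q x y hxy => by
    by_cases hy : y ∈ B q
    · have hx : x ∈ B q := fun i hi => (hxy i).trans (hy i hi)
      simp [hx, hy]
    · simp [hy]
  have key := hS.isAssociated_grid hM N _ _ (hB p) (hB fun i => ¬ p i)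
    (measurable_one.indicator (mB _)) (measurable_one.indicator (mB _))
  have hinter : ∀ x, (B p).indicator (1 : (Fin N → ℝ) → ℝ≥0∞) x *
      (B fun i => ¬ p i).indicator 1 x = (B p ∩ B fun i => ¬ p i).indicator 1 x := fun x => by
    rw [inter_indicator_one]; rfl
  simp_rw [hinter] at key
  rw [lintegral_indicator_one (mB _), lintegral_indicator_one (mB _),
    lintegral_indicator_one ((mB _).inter (mB _)), Measure.map_apply hX (mB _),
    Measure.map_apply hX (mB _), Measure.map_apply hX ((mB _).inter (mB _))] at key
  exact key.trans (measure_mono fun ω hω i => (em (p i)).elim (hω.1 i) (hω.2 i))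

theorem mul_le_measure_forall_le (hS : IsSlepian μ S) (c : ℝ) {m : ℕ} (hm : 0 < m) (a b : ℕ) :
    μ {ω | ∀ u ∈ Icc 0 ((a : ℝ) / m), S u ω < c} * μ {ω | ∀ u ∈ Icc 0 ((b : ℝ) / m), S u ω < c} ≤
      μ {ω | ∀ u ∈ Icc 0 (((a + b : ℕ) : ℝ) / m), S u ω ≤ c} := by
  have := hS.1
  have hm' : (0 : ℝ) < m := by exact_mod_cast hm
  rw [← hS.measure_forall_lt_shift (a / m) c (by positivity : 0 ≤ (b : ℝ) / m)]
  let M : ℕ → ℕ := fun r => m * (r + 1)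
  have hM : ∀ r, 0 < M r := fun r => by positivity
  have hM' : ∀ r, (0 : ℝ) < M r := fun r => by exact_mod_cast hM r
  let N : ℕ → ℕ := fun r => (a + b) * (r + 1) + 1
  have hdiv : ∀ (k r : ℕ), (k : ℝ) / m = ((k * (r + 1) : ℕ) : ℝ) / M r := fun k r => by
    simp only [M]; push_cast; field_simp
  refine le_measure_of_forall_frequently_mem
    (G := fun r => {ω | ∀ i : Fin (N r), S ((i : ℕ) / M r) ω ≤ c}) (fun r => ?_) (fun r => ?_) ?_
  · simp_rw [ofPred_forall]
    exact MeasurableSet.iInter fun i => measurableSet_le (hS.2.1 _) measurable_const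
  · refine le_trans ?_ (hS.measure_grid_mul_le (hM r) (N r) c fun i => (i : ℕ) ≤ a * (r + 1))
    refine mul_le_mul' (measure_mono fun ω hω i hi => (hω _ ⟨by positivity, ?_⟩).le)
      (measure_mono fun ω hω i hi => (hω _ ⟨?_, ?_⟩).le)
    · rw [hdiv a r]
      gcongr
    · rw [hdiv a r]
      gcongr
      exact (not_le.1 hi).le
    · rw [← add_div, ← Nat.cast_add, hdiv (a + b) r]
      gcongr
      exact Nat.lt_succ_iff.1 i.2
  · intro ω hω u hu
    have hMt : Tendsto (fun r => (M r : ℝ)) atTop atTop :=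
      tendsto_natCast_atTop_atTop.comp
        (tendsto_atTop_mono (fun r => (by simp only [M]; nlinarith : r ≤ M r)) tendsto_id)
    have ht : Tendsto (fun r => (⌊u * M r⌋₊ : ℝ) / M r) atTop (𝓝 u) :=
      (tendsto_nat_floor_mul_div_atTop hu.1).comp hMt
    refine isClosed_Iic.mem_of_frequently_of_tendsto (hω.mono fun r hr => ?_)
      (((hS.2.2.1 ω).tendsto u).comp ht)
    refine hr ⟨⌊u * M r⌋₊, Nat.lt_succ_iff.2 (Nat.floor_le_of_le ?_)⟩
    have := hu.2
    rw [hdiv (a + b) r, le_div_iff₀ (hM' r)] at this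
    exact this

theorem tendsto_measure_forall_lt (hS : IsSlepian μ S) (h : ℝ) {t : ℝ} (ht : 0 ≤ t) :
    Tendsto (fun k : ℕ => μ {ω | ∀ u ∈ Icc 0 t, S u ω < h - 1 / ((k : ℝ) + 1)}) atTop
      (𝓝 (μ {ω | ∀ u ∈ Icc 0 t, S u ω < h})) := by
  have hE : {ω | ∀ u ∈ Icc 0 t, S u ω < h} =
      ⋃ k : ℕ, {ω | ∀ u ∈ Icc 0 t, S u ω < h - 1 / ((k : ℝ) + 1)} := by
    ext ω
    simp only [mem_ofPred_eq, mem_iUnion]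
    constructor
    · intro H
      obtain ⟨t₀, ht₀, hmax⟩ := isCompact_Icc.exists_isMaxOn ⟨0, le_rfl, ht⟩
        (hS.2.2.1 ω).continuousOn
      obtain ⟨k, hk⟩ := exists_nat_one_div_lt (sub_pos.2 (H t₀ ht₀))
      exact ⟨k, fun u hu => lt_of_le_of_lt (hmax hu) (by linarith)⟩
    · rintro ⟨k, hk⟩ u hu
      have hk' : (0 : ℝ) < 1 / ((k : ℝ) + 1) := Nat.one_div_pos_of_nat
      linarith [hk u hu]
  rw [hE]
  exact tendsto_measure_iUnion_atTop fun k l hkl ω hω u hu =>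
    (hω u hu).trans_le (sub_le_sub_left (Nat.one_div_le_one_div hkl) _)

theorem mul_le_measure_forall_lt (hS : IsSlepian μ S) (h : ℝ) {m : ℕ} (hm : 0 < m) (a b : ℕ) :
    μ {ω | ∀ u ∈ Icc 0 ((a : ℝ) / m), S u ω < h} * μ {ω | ∀ u ∈ Icc 0 ((b : ℝ) / m), S u ω < h} ≤
      μ {ω | ∀ u ∈ Icc 0 (((a + b : ℕ) : ℝ) / m), S u ω < h} := by
  have := hS.1
  refine le_of_tendsto' (ENNReal.Tendsto.mul
    (hS.tendsto_measure_forall_lt h (by positivity : 0 ≤ (a : ℝ) / m))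
    (.inr (measure_ne_top _ _))
    (hS.tendsto_measure_forall_lt h (by positivity : 0 ≤ (b : ℝ) / m))
    (.inr (measure_ne_top _ _))) fun k => ?_
  refine (hS.mul_le_measure_forall_le _ hm a b).trans (measure_mono fun ω hω u hu => ?_)
  have hk' : (0 : ℝ) < 1 / ((k : ℝ) + 1) := Nat.one_div_pos_of_nat
  linarith [hω u hu]

end IsSlepian

namespace IsSlepian

variable {Ω : Type*} [MeasurableSpace Ω] {μ : Measure Ω} {S : ℝ → Ω → ℝ}

theorem measure_lt_ne_zero (hS : IsSlepian μ S) (t h : ℝ) : μ {ω | S t ω < h} ≠ 0 := by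
  have hg := (hS.isGaussianProcess.hasGaussianLaw_eval t).map_eq_gaussianReal
  have hv : Var[S t; μ] = 1 := by
    rw [← covariance_self (hS.2.1 t).aemeasurable, hS.covariance_eq]
    simp
  have hpre : μ {ω | S t ω < h} = μ.map (S t) (Iio h) :=
    (Measure.map_apply (hS.2.1 t) measurableSet_Iio).symm
  rw [hpre, hg, hv]
  intro h0
  have := gaussianReal_absolutelyContinuous' (∫ ω, S t ω ∂μ)
    (by simp : (1 : ℝ).toNNReal ≠ 0) h0
  simp at this

theorem exists_measure_forall_lt_ne_zero (hS : IsSlepian μ S) (h : ℝ) :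
    ∃ m : ℕ, 0 < m ∧ μ {ω | ∀ u ∈ Icc 0 ((1 : ℝ) / m), S u ω < h} ≠ 0 := by
  by_contra! H
  refine hS.measure_lt_ne_zero 0 h (measure_mono_null (fun ω hω => ?_)
    (measure_iUnion_null fun k : ℕ => H (k + 1) k.succ_pos))
  have hnhds : ∀ᶠ u in 𝓝 (0 : ℝ), S u ω < h :=
    (hS.2.2.1 ω).continuousAt.eventually_lt continuousAt_const hω
  obtain ⟨ε, hε, hball⟩ := Metric.eventually_nhds_iff.1 hnhds
  obtain ⟨k, hk⟩ := exists_nat_one_div_lt hε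
  refine mem_iUnion.2 ⟨k, fun u hu => hball ?_⟩
  rw [Real.dist_eq, sub_zero, abs_of_nonneg hu.1]
  refine hu.2.trans_lt ?_
  push_cast
  exact hk

theorem slepF_anti_s1 (hS : IsSlepian μ S) (h : ℝ) : Antitone fun T => slepF μ S T h := by
  have := hS.1
  exact fun s t hst => ENNReal.toReal_mono (measure_ne_top _ _)
    (measure_mono fun ω hω u hu => hω u ⟨hu.1, hu.2.trans hst⟩)

theorem slepF_pos (hS : IsSlepian μ S) (h T : ℝ) : 0 < slepF μ S T h := by
  have := hS.1
  obtain ⟨m, hm, hne⟩ := hS.exists_measure_forall_lt_ne_zero h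
  have hm' : (0 : ℝ) < m := by exact_mod_cast hm
  have key : ∀ k : ℕ, μ {ω | ∀ u ∈ Icc 0 (((k + 1 : ℕ) : ℝ) / m), S u ω < h} ≠ 0 := by
    intro k
    induction k with
    | zero => simpa using hne
    | succ k ih =>
      have hmul := hS.mul_le_measure_forall_lt h hm (k + 1) 1
      rw [Nat.cast_one] at hmul
      exact ((pos_iff_ne_zero.2 (mul_ne_zero ih hne)).trans_le hmul).ne'
  obtain ⟨k, hk⟩ := exists_nat_ge (T * m)
  have hTk : T ≤ ((k + 1 : ℕ) : ℝ) / m := by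
    rw [le_div_iff₀ hm']
    push_cast
    linarith
  exact (ENNReal.toReal_pos (key k) (measure_ne_top _ _)).trans_le (hS.slepF_anti_s1 h hTk)

theorem slepF_mul_le_s1 (hS : IsSlepian μ S) (h : ℝ) (a b : ℕ) :
    slepF μ S a h * slepF μ S b h ≤ slepF μ S (a + b : ℕ) h := by
  have := hS.1
  have hmul := hS.mul_le_measure_forall_lt h one_pos a b
  simp only [Nat.cast_one, div_one] at hmul
  rw [slepF, slepF, ← ENNReal.toReal_mul]
  exact ENNReal.toReal_mono (measure_ne_top _ _) hmul

theorem slepF_add_one_add_le (hS : IsSlepian μ S) (h : ℝ) {s t : ℝ} (hs : 0 ≤ s) (ht : 0 ≤ t) :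
    slepF μ S (s + 1 + t) h ≤ slepF μ S s h * slepF μ S t h := by
  have := hS.1
  rw [slepF, slepF, slepF, ← ENNReal.toReal_mul]
  exact ENNReal.toReal_mono (ENNReal.mul_ne_top (measure_ne_top _ _) (measure_ne_top _ _))
    (hS.measure_forall_lt_le_mul h hs ht)

theorem pow_slepF_le (hS : IsSlepian μ S) (h : ℝ) (n k : ℕ) :
    slepF μ S n h ^ (k + 1) ≤ slepF μ S ((k + 1) * n : ℕ) h := by
  induction k with
  | zero => simp
  | succ k ih =>
    rw [pow_succ, show (k + 1 + 1) * n = (k + 1) * n + n by ring]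
    exact (mul_le_mul_of_nonneg_right ih (hS.slepF_pos h _).le).trans (hS.slepF_mul_le_s1 h _ _)

theorem slepF_le_pow (hS : IsSlepian μ S) (h : ℝ) (n k : ℕ) :
    slepF μ S ((k + 1) * (n + 1) : ℕ) h ≤ slepF μ S n h ^ (k + 1) := by
  induction k with
  | zero =>
    rw [zero_add, one_mul, pow_one]
    exact hS.slepF_anti_s1 h (by push_cast; linarith)
  | succ k ih =>
    rw [pow_succ', show (((k + 1 + 1) * (n + 1) : ℕ) : ℝ) =
      n + 1 + ((k + 1) * (n + 1) : ℕ) by push_cast; ring]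
    exact (hS.slepF_add_one_add_le h (Nat.cast_nonneg _) (Nat.cast_nonneg _)).trans
      (mul_le_mul_of_nonneg_left ih (hS.slepF_pos h _).le)

end IsSlepian

theorem tendsto_natCast_succ_mul_atTop {n : ℕ} (hn : 0 < n) :
    Tendsto (fun k : ℕ => (((k + 1) * n : ℕ) : ℝ)) atTop atTop :=
  tendsto_natCast_atTop_atTop.comp
    (tendsto_atTop_mono (fun k => by nlinarith : ∀ k, k ≤ (k + 1) * n) tendsto_id)

/-- For every real `h` and every positive integer `n`, Shepp's constant `Λ(h)` satisfies
`-(1/(n+1)) log F_n(h) ≤ Λ(h) ≤ -(1/n) log F_n(h)`. -/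
theorem shepp_constant_bounds {Ω : Type*} [MeasurableSpace Ω] (μ : Measure Ω)
    (S : ℝ → Ω → ℝ) (hS : IsSlepian μ S) (h : ℝ) (L : ℝ)
    (hL : Filter.Tendsto (fun T : ℝ => -(1 / T) * Real.log (slepF μ S T h))
      Filter.atTop (nhds L))
    (n : ℕ) (hn : 0 < n) :
    -(1 / ((n : ℝ) + 1)) * Real.log (slepF μ S (n : ℝ) h) ≤ L ∧
      L ≤ -(1 / (n : ℝ)) * Real.log (slepF μ S (n : ℝ) h) := by
  constructor
  · refine ge_of_tendsto' (hL.comp (tendsto_natCast_succ_mul_atTop n.succ_pos)) fun k => ?_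
    have hlog := Real.log_le_log (hS.slepF_pos h _) (hS.slepF_le_pow h n k)
    rw [Real.log_pow] at hlog
    simp only [Function.comp_apply, neg_mul]
    refine neg_le_neg ((mul_le_mul_of_nonneg_left hlog (by positivity)).trans_eq ?_)
    push_cast
    field_simp
  · refine le_of_tendsto' (hL.comp (tendsto_natCast_succ_mul_atTop hn)) fun k => ?_
    have hlog := Real.log_le_log (pow_pos (hS.slepF_pos h n) _) (hS.pow_slepF_le h n k)
    rw [Real.log_pow] at hlog
    have hn' : (0 : ℝ) < n := by exact_mod_cast hn
    simp only [Function.comp_apply, neg_mul]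
    refine neg_le_neg (Eq.trans_le ?_ (mul_le_mul_of_nonneg_left hlog (by positivity)))
    push_cast
    field_simp
end
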